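/- Let D ≥ 2 be an integer and let M be a (D-1)×D real matrix of rank D-1. Then there exists exactly one unit vector u ∈ ℝ^D such that M·u = 0 and u lies in the image of the hyperpolar map, i.e. u = c(φ) for some φ ∈ (-π/2, π/2]^{D-1}; equivalently, the set { c(φ) : φ ∈ (-π/2, π/2]^{D-1}, M·c(φ) = 0 } is a singleton. -/

import Mathlib

open Real Set Matrix

/-- The hyperpolar vector `c(φ) ∈ ℝ^D` of angles `φ = (φ_1, …, φ_{D-1})`:
`c(φ)_k = cos φ_1 ⋯ cos φ_{k-1} · sin φ_k` for `k < D` and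
`c(φ)_D = cos φ_1 ⋯ cos φ_{D-1}` (indices here are 0-based). -/
noncomputable def hyperpolar (D : ℕ) (φ : Fin (D - 1) → ℝ) : Fin D → ℝ :=
  fun k =>
    (∏ j ∈ Finset.univ.filter (fun j : Fin (D - 1) => (j : ℕ) < (k : ℕ)), Real.cos (φ j)) *
      (if h : (k : ℕ) < D - 1 then Real.sin (φ ⟨k, h⟩) else 1)

/-- The last nonzero coordinate of `u` exists and is positive. -/
def LastNonzeroPos {n : ℕ} (u : Fin n → ℝ) : Prop :=
  ∃ k, 0 < u k ∧ ∀ j, k < j → u j = 0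

theorem LastNonzeroPos.smul {n : ℕ} {u : Fin n → ℝ} (hu : LastNonzeroPos u) {c : ℝ}
    (hc : 0 < c) : LastNonzeroPos (c • u) := by
  obtain ⟨k, hk, h0⟩ := hu
  exact ⟨k, by simpa using mul_pos hc hk, fun j hj => by simp [h0 j hj]⟩

theorem LastNonzeroPos.not_neg {n : ℕ} {u : Fin n → ℝ} (hu : LastNonzeroPos u) :
    ¬ LastNonzeroPos (-u) := by
  obtain ⟨k, hk, h0⟩ := hu
  rintro ⟨l, hl, h1⟩
  simp only [Pi.neg_apply, neg_eq_zero] at hl h1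
  rcases lt_trichotomy k l with h | h | h
  · linarith [h0 l h]
  · subst h
    linarith
  · linarith [h1 k h]

theorem lastNonzeroPos_or_neg {n : ℕ} {u : Fin n → ℝ} (hu : u ≠ 0) :
    LastNonzeroPos u ∨ LastNonzeroPos (-u) := by
  obtain ⟨i, hi⟩ := Function.ne_iff.mp hu
  obtain ⟨k, hk, hmax⟩ := Finset.exists_max_image (Finset.univ.filter fun j => u j ≠ 0) id
    ⟨i, by simpa using hi⟩
  simp only [Finset.mem_filter, Finset.mem_univ, true_and, id] at hk hmax
  have h0 : ∀ j, k < j → u j = 0 := fun j hj => by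
    by_contra h
    exact absurd (hmax j h) (not_le.mpr hj)
  rcases lt_or_gt_of_ne hk with h | h
  · exact Or.inr ⟨k, by simpa using h, fun j hj => by simp [h0 j hj]⟩
  · exact Or.inl ⟨k, h, h0⟩

theorem hyperpolar_cons (n : ℕ) (a : ℝ) (φ : Fin n → ℝ) :
    hyperpolar (n + 2) (Fin.cons a φ : Fin (n + 1) → ℝ) =
      Fin.cons (Real.sin a) (Real.cos a • hyperpolar (n + 1) φ) := by
  funext k
  refine Fin.cases ?_ (fun k => ?_) k
  · simp [hyperpolar]
  · have hprod : (∏ j ∈ Finset.univ.filter (fun j : Fin (n + 1) => (j : ℕ) < (k : ℕ) + 1),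
        Real.cos ((Fin.cons a φ : Fin (n + 1) → ℝ) j)) =
        Real.cos a * ∏ j ∈ Finset.univ.filter (fun j : Fin n => (j : ℕ) < (k : ℕ)),
          Real.cos (φ j) := by
      rw [Finset.prod_filter, Fin.prod_univ_succ, Finset.prod_filter]
      simp
    have hlast : (if h : (k : ℕ) + 1 < n + 1 then
          Real.sin ((Fin.cons a φ : Fin (n + 1) → ℝ) ⟨k + 1, h⟩) else 1) =
        if h : (k : ℕ) < n then Real.sin (φ ⟨k, h⟩) else 1 := by
      by_cases h : (k : ℕ) < n
      · rw [dif_pos h, dif_pos (Nat.succ_lt_succ h)]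
        exact congrArg Real.sin (Fin.cons_succ (α := fun _ => ℝ) a φ ⟨k, h⟩)
      · rw [dif_neg h, dif_neg (by omega)]
    rw [Fin.cons_succ, Pi.smul_apply, smul_eq_mul]
    exact (congrArg₂ (· * ·) hprod hlast).trans (mul_assoc _ _ _)

theorem hyperpolar_one (φ : Fin 0 → ℝ) : hyperpolar 1 φ = fun _ => 1 := by
  funext k
  simp [hyperpolar]

theorem lastNonzeroPos_hyperpolar (n : ℕ) (φ : Fin n → ℝ)
    (hφ : ∀ j, φ j ∈ Set.Ioc (-(π / 2)) (π / 2)) : LastNonzeroPos (hyperpolar (n + 1) φ) := by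
  induction n with
  | zero =>
    rw [hyperpolar_one]
    exact ⟨0, one_pos, fun j hj => absurd hj (by simp [Fin.eq_zero j])⟩
  | succ n ih =>
    obtain ⟨a, ψ, rfl⟩ : ∃ (a : ℝ) (ψ : Fin n → ℝ), φ = Fin.cons a ψ :=
      ⟨φ 0, Fin.tail φ, (Fin.cons_self_tail φ).symm⟩
    have ha : a ∈ Set.Ioc (-(π / 2)) (π / 2) := by simpa using hφ 0
    obtain ⟨k, hk, h0⟩ := ih ψ fun j => by simpa using hφ j.succ
    rw [hyperpolar_cons]
    rcases ha.2.eq_or_lt with h | h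
    · subst h
      refine ⟨0, by simp, fun j hj => ?_⟩
      obtain ⟨i, rfl⟩ := Fin.exists_succ_eq.mpr hj.ne'
      simp
    · have hc : 0 < Real.cos a := Real.cos_pos_of_mem_Ioo ⟨ha.1, h⟩
      refine ⟨k.succ, by simpa using mul_pos hc hk, fun j hj => ?_⟩
      obtain ⟨i, rfl⟩ := Fin.exists_succ_eq.mpr ((Fin.zero_le _).trans_lt hj).ne'
      simp [h0 i (Fin.succ_lt_succ_iff.mp hj)]

theorem exists_hyperpolar_eq (n : ℕ) (u : Fin (n + 1) → ℝ) (hu : ∑ k, u k ^ 2 = 1)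
    (hpos : LastNonzeroPos u) : ∃ φ : Fin n → ℝ,
      (∀ j, φ j ∈ Set.Ioc (-(π / 2)) (π / 2)) ∧ hyperpolar (n + 1) φ = u := by
  induction n with
  | zero =>
    refine ⟨Fin.elim0, fun j => j.elim0, ?_⟩
    obtain ⟨k, hk, -⟩ := hpos
    rw [hyperpolar_one]
    funext j
    simp only [Fin.sum_univ_succ, Finset.univ_eq_empty, Finset.sum_empty, add_zero] at hu
    rw [Fin.eq_zero k] at hk
    rw [Fin.eq_zero j]
    nlinarith
  | succ n ih =>
    obtain ⟨s, w, rfl⟩ : ∃ (s : ℝ) (w : Fin (n + 1) → ℝ), u = Fin.cons s w :=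
      ⟨u 0, Fin.tail u, (Fin.cons_self_tail u).symm⟩
    rw [Fin.sum_univ_succ] at hu
    simp only [Fin.cons_zero, Fin.cons_succ] at hu
    obtain ⟨k, hk, h0⟩ := hpos
    induction k using Fin.cases with
    | zero =>
      have hw : w = 0 := funext fun i => by simpa using h0 i.succ i.succ_pos
      subst hw
      simp only [Fin.cons_zero] at hk
      have hs : s = 1 := by
        simp only [Pi.zero_apply, ne_eq, OfNat.ofNat_ne_zero, not_false_eq_true, zero_pow,
          Finset.sum_const_zero, add_zero] at hu
        nlinarith
      refine ⟨Fin.cons (π / 2) fun _ => 0, fun j => ?_, ?_⟩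
      · refine Fin.cases ?_ (fun j => ?_) j
        · simp only [Fin.cons_zero]
          constructor <;> linarith [Real.pi_pos]
        · simp only [Fin.cons_succ]
          constructor <;> linarith [Real.pi_pos]
      · rw [hyperpolar_cons]
        simp [hs]
    | succ k =>
      simp only [Fin.cons_succ] at hk
      have hsum : 0 < ∑ i, w i ^ 2 :=
        Finset.sum_pos' (fun i _ => sq_nonneg _) ⟨k, Finset.mem_univ _, by positivity⟩
      have hs : -1 < s ∧ s < 1 := abs_lt.mp ((sq_lt_one_iff_abs_lt_one s).mp (by linarith))
      have hc : 0 < Real.cos (Real.arcsin s) := by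
        rw [Real.cos_arcsin]
        exact Real.sqrt_pos.mpr (by linarith)
      have hc2 : Real.cos (Real.arcsin s) ^ 2 = ∑ i, w i ^ 2 := by
        rw [Real.cos_arcsin, Real.sq_sqrt] <;> linarith
      have hwpos : LastNonzeroPos w :=
        ⟨k, hk, fun j hj => by simpa using h0 j.succ (Fin.succ_lt_succ_iff.mpr hj)⟩
      obtain ⟨φ, hφ, he⟩ := ih ((Real.cos (Real.arcsin s))⁻¹ • w)
        (by
          simp only [Pi.smul_apply, smul_eq_mul, mul_pow]
          rw [← Finset.mul_sum, ← hc2]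
          field_simp)
        (hwpos.smul (inv_pos.mpr hc))
      refine ⟨Fin.cons (Real.arcsin s) φ, fun j => ?_, ?_⟩
      · refine Fin.cases ?_ (fun j => ?_) j
        · exact ⟨Real.neg_pi_div_two_lt_arcsin.mpr hs.1, Real.arcsin_le_pi_div_two s⟩
        · simpa using hφ j
      · rw [hyperpolar_cons, he, smul_inv_smul₀ hc.ne', Real.sin_arcsin hs.1.le hs.2.le]

theorem exists_unit_lastNonzeroPos_smul {n : ℕ} {v : Fin n → ℝ} (hv : v ≠ 0) :
    ∃ c : ℝ, ∑ k, (c • v) k ^ 2 = 1 ∧ LastNonzeroPos (c • v) := by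
  have hsum : 0 < ∑ k, v k ^ 2 := by
    obtain ⟨i, hi⟩ := Function.ne_iff.mp hv
    exact Finset.sum_pos' (fun k _ => sq_nonneg _) ⟨i, Finset.mem_univ _, sq_pos_of_ne_zero (by simpa using hi)⟩
  have hr : 0 < (√(∑ k, v k ^ 2))⁻¹ := inv_pos.mpr (Real.sqrt_pos.mpr hsum)
  have hnorm : ((√(∑ k, v k ^ 2))⁻¹) ^ 2 * ∑ k, v k ^ 2 = 1 := by
    rw [inv_pow, Real.sq_sqrt hsum.le, inv_mul_cancel₀ hsum.ne']
  rcases lastNonzeroPos_or_neg hv with h | h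
  · refine ⟨_, ?_, h.smul hr⟩
    simpa only [Pi.smul_apply, smul_eq_mul, mul_pow, ← Finset.mul_sum] using hnorm
  · refine ⟨-(√(∑ k, v k ^ 2))⁻¹, ?_, by simpa using h.smul hr⟩
    simpa only [Pi.smul_apply, smul_eq_mul, mul_pow, neg_sq, ← Finset.mul_sum] using hnorm

theorem eq_of_smul_of_lastNonzeroPos {n : ℕ} {u : Fin n → ℝ} {c : ℝ}
    (hu : ∑ k, u k ^ 2 = 1) (hcu : ∑ k, (c • u) k ^ 2 = 1)
    (hpos : LastNonzeroPos u) (hcpos : LastNonzeroPos (c • u)) : c • u = u := by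
  simp only [Pi.smul_apply, smul_eq_mul, mul_pow] at hcu
  rw [← Finset.mul_sum, hu, mul_one] at hcu
  rcases eq_or_eq_neg_of_sq_eq_sq c 1 (by rw [hcu, one_pow]) with h | h
  · rw [h, one_smul]
  · rw [h, neg_one_smul] at hcpos
    exact absurd hcpos hpos.not_neg

theorem finrank_ker_mulVecLin_eq_one {n : ℕ} (M : Matrix (Fin n) (Fin (n + 1)) ℝ)
    (hrank : M.rank = n) : Module.finrank ℝ (LinearMap.ker M.mulVecLin) = 1 := by
  have h := LinearMap.finrank_range_add_finrank_ker M.mulVecLin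
  rw [Module.finrank_fin_fun] at h
  change M.rank + _ = _ at h
  omega

theorem stmt12 (D : ℕ) (hD : 2 ≤ D) (M : Matrix (Fin (D - 1)) (Fin D) ℝ)
    (hrank : M.rank = D - 1) :
    ∃! u : Fin D → ℝ, (∑ k, u k ^ 2 = 1) ∧ M *ᵥ u = 0 ∧
      ∃ φ : Fin (D - 1) → ℝ,
        (∀ j, φ j ∈ Set.Ioc (-(π / 2)) (π / 2)) ∧ hyperpolar D φ = u := by
  obtain ⟨n, rfl⟩ : ∃ n, D = n + 1 := ⟨D - 1, by omega⟩
  obtain ⟨⟨v, hMv⟩, hv, hspan⟩ := finrank_eq_one_iff'.mp (finrank_ker_mulVecLin_eq_one M hrank)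
  obtain ⟨c, hc, hpos⟩ := exists_unit_lastNonzeroPos_smul (v := v)
    (fun h => hv (Subtype.ext h))
  refine ⟨c • v, ⟨hc, ?_, exists_hyperpolar_eq n _ hc hpos⟩, ?_⟩
  · have h : M *ᵥ v = 0 := hMv
    rw [Matrix.mulVec_smul, h, smul_zero]
  · rintro u ⟨hu, hMu, φ, hφ, rfl⟩
    have hupos := lastNonzeroPos_hyperpolar n φ hφ
    obtain ⟨d, hd⟩ := hspan ⟨_, hMu⟩
    have hd' : d • v = hyperpolar (n + 1) φ := congrArg Subtype.val hd
    have hd0 : d ≠ 0 := by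
      rintro rfl
      rw [← hd'] at hu
      simp at hu
    have hv' : v = d⁻¹ • hyperpolar (n + 1) φ := by
      rw [← hd', inv_smul_smul₀ hd0]
    rw [hv', smul_smul] at hc hpos ⊢
    exact (eq_of_smul_of_lastNonzeroPos hu hc hupos hpos).symm
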